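/- arXiv:2408.09607 — 6 statements merged into one kernel-verified Lean document; each statement's English description precedes it below -/
import Mathlib

section
/- Let n ≥ 1 be an integer, p ∈ (0,1), and y(1), y(0) ∈ ℝⁿ. For an assignment vector w ∈ {0,1}ⁿ that has at least one entry equal to 1 and at least one entry equal to 0, define the difference-in-means value DM(w) = (∑_{j : w_j = 1} y_j(1)) / |{j : w_j = 1}| − (∑_{j : w_j = 0} y_j(0)) / |{j : w_j = 0}|. Then ∑_{w ∈ {0,1}ⁿ, w ≠ (0,…,0), w ≠ (1,…,1)} (∏_{j=1}^n p^{w_j}(1−p)^{1−w_j}) · DM(w) = (1 − pⁿ − (1−p)ⁿ) · (1/n) ∑_{j=1}^n (y_j(1) − y_j(0)). Equivalently, under the Bernoulli(p) design, the difference-in-means estimator conditional on the assignment being non-degenerate is unbiased for the finite-sample average treatment effect. -/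
open Finset

lemma dm_aux (n : ℕ) (hn : 1 ≤ n) (b : Bool) (g : (Fin n → Bool) → ℝ)
    (hg : ∀ (σ : Equiv.Perm (Fin n)) w, g (w ∘ σ) = g w)
    (h0 : ∀ w, (¬ ∃ j, w j = b) → g w = 0) (y : Fin n → ℝ) :
    ∑ w : Fin n → Bool, g w * ((∑ j ∈ univ.filter (fun j => w j = b), y j) /
      ((univ.filter (fun j => w j = b)).card : ℝ))
    = (∑ w, g w) * ((1 / (n : ℝ)) * ∑ j, y j) := by
  have hn' : (n : ℝ) ≠ 0 := by positivity
  let c : Fin n → ℝ := fun j => ∑ w : Fin n → Bool,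
    g w * ((if w j = b then 1 else 0) / ((univ.filter (fun j => w j = b)).card : ℝ))
  have hcc : ∀ j k, c j = c k := by
    intro j k
    refine Fintype.sum_equiv (Equiv.arrowCongr (Equiv.swap j k) (Equiv.refl Bool)) _ _ ?_
    intro w
    have e : (Equiv.arrowCongr (Equiv.swap j k) (Equiv.refl Bool)) w = w ∘ (Equiv.swap j k) := by
      ext i
      simp [Equiv.arrowCongr]
    rw [e, hg]
    have hc : (univ.filter (fun i => (w ∘ (Equiv.swap j k)) i = b)).card
        = (univ.filter (fun i => w i = b)).card := by
      refine Finset.card_equiv (Equiv.swap j k) ?_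
      intro i
      simp
    rw [hc]
    simp
  have hsum : ∑ j, c j = ∑ w, g w := by
    simp only [c]
    rw [Finset.sum_comm]
    refine Finset.sum_congr rfl fun w _ => ?_
    rw [← Finset.mul_sum, ← Finset.sum_div]
    by_cases h : ∃ j, w j = b
    · have hpos : ((univ.filter (fun j => w j = b)).card : ℝ) ≠ 0 := by
        obtain ⟨j, hj⟩ := h
        have : 0 < (univ.filter (fun j => w j = b)).card :=
          Finset.card_pos.mpr ⟨j, by simp [hj]⟩
        positivity
      rw [Finset.sum_boole, div_self hpos, mul_one]
    · rw [h0 w h, zero_mul]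
  have hc : ∀ j, c j = (∑ w, g w) * (1 / (n : ℝ)) := by
    intro j
    have : ∑ k, c k = n * c j := by
      rw [Finset.sum_congr rfl fun k _ => hcc k j]
      simp
    rw [← hsum, this]
    field_simp
  calc _ = ∑ j, c j * y j := by
        simp only [c, Finset.sum_mul]
        rw [Finset.sum_comm]
        refine Finset.sum_congr rfl fun w _ => ?_
        rw [Finset.sum_filter, Finset.sum_div, Finset.mul_sum]
        refine Finset.sum_congr rfl fun j _ => ?_
        split_ifs <;> ring
    _ = _ := by
        simp only [hc]
        rw [← Finset.mul_sum]
        ring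

/-- Under the Bernoulli(p) design, the difference-in-means estimator conditional on the
assignment being non-degenerate is unbiased for the finite-sample average treatment effect. -/
theorem bernoulli_dm_conditionally_unbiased
    (n : ℕ) (hn : 1 ≤ n) (p : ℝ) (hp0 : 0 < p) (hp1 : p < 1)
    (y1 y0 : Fin n → ℝ) :
    ∑ w : Fin n → Bool,
      (if (∃ j, w j = true) ∧ (∃ j, w j = false) then
        (∏ j, if w j then p else 1 - p) *
          ((∑ j ∈ univ.filter (fun j => w j = true), y1 j) /
              ((univ.filter (fun j => w j = true)).card : ℝ)
            - (∑ j ∈ univ.filter (fun j => w j = false), y0 j) /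
              ((univ.filter (fun j => w j = false)).card : ℝ))
      else 0)
    = (1 - p ^ n - (1 - p) ^ n) * ((1 / (n : ℝ)) * ∑ j, (y1 j - y0 j)) := by
  let g : (Fin n → Bool) → ℝ := fun w =>
    if (∃ j, w j = true) ∧ (∃ j, w j = false) then (∏ j, if w j then p else 1 - p) else 0
  have hg : ∀ (σ : Equiv.Perm (Fin n)) w, g (w ∘ σ) = g w := by
    intro σ w
    have h1 : ∀ b, (∃ j, (w ∘ σ) j = b) ↔ ∃ j, w j = b := fun b =>
      σ.surjective.exists (p := fun j => w j = b) |>.symm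
    have h2 : (∏ j, if (w ∘ σ) j then p else 1 - p) = ∏ j, if w j then p else 1 - p :=
      Equiv.prod_comp σ (fun j => if w j then p else 1 - p)
    simp only [g, h1, h2]
  have hG : ∑ w, g w = 1 - p ^ n - (1 - p) ^ n := by
    have e : ∀ w, g w = (∏ j, if w j then p else 1 - p)
        - (if w = (fun _ => true) then p ^ n else 0)
        - (if w = (fun _ => false) then (1 - p) ^ n else 0) := by
      intro w
      have j0 : Fin n := ⟨0, hn⟩
      by_cases hT : w = fun _ => true
      · have : (fun _ : Fin n => true) ≠ fun _ => false := fun h => by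
          simpa using congrFun h j0
        subst hT
        simp [g, this]
      by_cases hF : w = fun _ => false
      · subst hF
        simp [g, hT]
      have a : ∃ j, w j = true := by
        by_contra h
        exact hF (funext fun j => by simpa using not_exists.mp h j)
      have a' : ∃ j, w j = false := by
        by_contra h
        exact hT (funext fun j => by simpa using not_exists.mp h j)
      simp only [g, if_pos (And.intro a a'), if_neg hT, if_neg hF, sub_zero]
    have hs : ∑ w : Fin n → Bool, (∏ j, if w j then p else 1 - p) = 1 := by
      have := Finset.prod_univ_sum (fun _ : Fin n => (univ : Finset Bool))
        (fun _ b => if b then p else 1 - p)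
      rw [Fintype.piFinset_univ] at this
      rw [← this]
      simp
    simp only [e, Finset.sum_sub_distrib, hs]
    simp
  have A := dm_aux n hn true g hg (fun w h => by simp only [g]; rw [if_neg (fun k => h k.1)]) y1
  have B := dm_aux n hn false g hg (fun w h => by simp only [g]; rw [if_neg (fun k => h k.2)]) y0
  rw [hG] at A B
  rw [Finset.sum_sub_distrib, mul_sub, mul_sub, ← A, ← B, ← Finset.sum_sub_distrib]
  refine Finset.sum_congr rfl fun w _ => ?_
  simp only [g]
  split_ifs <;> ring
end

section
/- Let n ≥ 2 be an even integer and σ ≥ 0 a real number. Let W* = {w ∈ {0,1}ⁿ : 0 < ∑_j w_j < n}, and for w ∈ W* with n₁ = ∑_j w_j treated units and n₀ = n − n₁ control units, define the loss L(w, g) = ( (1/n₁) ∑_{j : w_j = 1} g_j − (1/n₀) ∑_{j : w_j = 0} g_j )² + σ² (1/n₁ + 1/n₀) for g ∈ ℝⁿ. For a probability mass function η on W*, define r(η, g) = ∑_{w ∈ W*} η(w) L(w, g). Let η* be the uniform distribution on {w ∈ {0,1}ⁿ : ∑_j w_j = n/2} (the balanced completely randomized design). Let G ⊆ ℝⁿ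 be nonempty and permutation invariant (g ∈ G implies every coordinate permutation of g lies in G). Then for any probability mass function η on W* for which {r(η, g) : g ∈ G} is bounded above, and for every g ∈ G, r(η*, g) ≤ sup_{g' ∈ G} r(η, g'); in particular the balanced completely randomized design is minimax optimal with respect to G: sup_{g ∈ G} r(η*, g) ≤ sup_{g ∈ G} r(η, g). -/
open Finset

/-- The set of treated units under assignment `w`. -/
def treatedSet (n : ℕ) (w : Fin n → Bool) : Finset (Fin n) :=
  Finset.univ.filter (fun j => w j = true)

/-- The loss of a non-degenerate assignment `w` at parameter `g`: the expected squared
error of the difference-in-means estimator under the additive model with noise level `σ`. -/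
noncomputable def dmLoss (n : ℕ) (σ : ℝ) (w : Fin n → Bool) (g : Fin n → ℝ) : ℝ :=
  ((∑ j ∈ treatedSet n w, g j) / ((treatedSet n w).card : ℝ)
      - (∑ j ∈ (treatedSet n w)ᶜ, g j) / (((treatedSet n w)ᶜ.card : ℕ) : ℝ)) ^ 2
    + σ ^ 2 * (1 / ((treatedSet n w).card : ℝ) + 1 / (((treatedSet n w)ᶜ.card : ℕ) : ℝ))

/-- The risk of a randomized design `η` supported on non-degenerate assignments. -/
noncomputable def dmRisk (n : ℕ) (σ : ℝ) (η : (Fin n → Bool) → ℝ) (g : Fin n → ℝ) : ℝ :=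
  ∑ w ∈ Finset.univ.filter
      (fun w : Fin n → Bool => 0 < (treatedSet n w).card ∧ (treatedSet n w).card < n),
    η w * dmLoss n σ w g

/-- The balanced completely randomized design: uniform over assignments with `n/2` treated. -/
noncomputable def balancedCRD (n : ℕ) : (Fin n → Bool) → ℝ := fun w =>
  if (treatedSet n w).card = n / 2 then 1 / (n.choose (n / 2) : ℝ) else 0

noncomputable def cw (n : ℕ) (w : Fin n → Bool) (j : Fin n) : ℝ :=
  if w j = true then 1 / ((treatedSet n w).card : ℝ) else -(1 / (((treatedSet n w)ᶜ.card : ℕ) : ℝ))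

lemma cw_sum (n : ℕ) (w : Fin n → Bool) (f : ℝ → Fin n → ℝ) :
    ∑ j, f (cw n w j) j = ∑ j ∈ treatedSet n w, f (1 / ((treatedSet n w).card : ℝ)) j
      + ∑ j ∈ (treatedSet n w)ᶜ, f (-(1 / (((treatedSet n w)ᶜ.card : ℕ) : ℝ))) j := by
  rw [← Finset.sum_add_sum_compl (treatedSet n w)]
  congr 1
  · refine Finset.sum_congr rfl fun j hj => ?_
    have : w j = true := by simpa [treatedSet] using hj
    simp [cw, this]
  · refine Finset.sum_congr rfl fun j hj => ?_
    have : w j = false := by simpa [treatedSet] using hj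
    simp [cw, this]

lemma dmLoss_eq (n : ℕ) (σ : ℝ) (w : Fin n → Bool) (g : Fin n → ℝ) :
    dmLoss n σ w g = (∑ j, cw n w j * g j) ^ 2
     + σ ^ 2 * (1 / ((treatedSet n w).card : ℝ) + 1 / (((treatedSet n w)ᶜ.card : ℕ) : ℝ)) := by
  rw [cw_sum n w (fun c j => c * g j), ← Finset.mul_sum, ← Finset.mul_sum, dmLoss]
  ring

lemma cw_sq (n : ℕ) (w : Fin n → Bool) :
    ∑ j, cw n w j ^ 2
      = 1 / ((treatedSet n w).card : ℝ) + 1 / (((treatedSet n w)ᶜ.card : ℕ) : ℝ) := by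
  rw [cw_sum n w (fun c j => c ^ 2)]
  simp only [Finset.sum_const, nsmul_eq_mul]
  congr 1
  · by_cases h : ((treatedSet n w).card : ℝ) = 0
    · simp [h]
    · field_simp
  · by_cases h : (((treatedSet n w)ᶜ.card : ℕ) : ℝ) = 0
    · rw [h]; simp
    · field_simp

lemma cw_zero (n : ℕ) (w : Fin n → Bool)
    (h : 0 < (treatedSet n w).card ∧ (treatedSet n w).card < n) :
    ∑ j, cw n w j = 0 := by
  rw [cw_sum n w (fun c j => c)]
  simp only [Finset.sum_const, nsmul_eq_mul]
  have h1 : ((treatedSet n w).card : ℝ) ≠ 0 := by exact_mod_cast h.1.ne'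
  have h2 : (((treatedSet n w)ᶜ.card : ℕ) : ℝ) ≠ 0 := by
    rw [Finset.card_compl, Fintype.card_fin]
    exact_mod_cast (by omega)
  field_simp
  ring

lemma card_comp (n : ℕ) (w : Fin n → Bool) (π : Equiv.Perm (Fin n)) :
    (treatedSet n (w ∘ π)).card = (treatedSet n w).card := by
  refine Finset.card_equiv π fun j => ?_
  simp [treatedSet]

lemma loss_comp (n : ℕ) (σ : ℝ) (w : Fin n → Bool) (g : Fin n → ℝ) (π : Equiv.Perm (Fin n)) :
    dmLoss n σ (w ∘ π) (g ∘ π) = dmLoss n σ w g := by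
  rw [dmLoss_eq, dmLoss_eq]
  have hc : ∀ j, cw n (w ∘ π) j = cw n w (π j) := by
    intro j
    simp only [cw, Finset.card_compl, card_comp, Function.comp]
  simp only [hc, Finset.card_compl, card_comp, Function.comp]
  rw [Equiv.sum_comp π (fun j => cw n w j * g j)]

lemma risk_inv (n : ℕ) (σ : ℝ) (g : Fin n → ℝ) (π : Equiv.Perm (Fin n)) :
    dmRisk n σ (balancedCRD n) (g ∘ π) = dmRisk n σ (balancedCRD n) g := by
  unfold dmRisk
  symm
  refine Finset.sum_equiv (Equiv.arrowCongr π.symm (Equiv.refl Bool)) ?_ ?_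
  · intro w
    have : (Equiv.arrowCongr π.symm (Equiv.refl Bool)) w = w ∘ π := by
      ext j; simp [Equiv.arrowCongr]
    simp only [this, card_comp, Finset.mem_filter, Finset.mem_univ, true_and]
  · intro w _
    have : (Equiv.arrowCongr π.symm (Equiv.refl Bool)) w = w ∘ π := by
      ext j; simp [Equiv.arrowCongr]
    rw [this, loss_comp]
    simp [balancedCRD, card_comp]

lemma exists_perm_pair {n : ℕ} {a b i j : Fin n} (hab : a ≠ b) (hij : i ≠ j) :
    ∃ τ : Equiv.Perm (Fin n), τ a = i ∧ τ b = j := by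
  refine ⟨(Equiv.swap a i).trans (Equiv.swap (Equiv.swap a i b) j), ?_, ?_⟩
  · have h1 : i ≠ Equiv.swap a i b := by
      intro h
      apply hab
      apply (Equiv.swap a i).injective
      rw [← h]; simp
    simp [Equiv.swap_apply_of_ne_of_ne h1 hij]
  · simp

lemma Q_const {n : ℕ} (g : Fin n → ℝ) {a b i j : Fin n} (hab : a ≠ b) (hij : i ≠ j) :
    ∑ π : Equiv.Perm (Fin n), (g (π i) - g (π j)) ^ 2
      = ∑ π : Equiv.Perm (Fin n), (g (π a) - g (π b)) ^ 2 := by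
  obtain ⟨τ, rfl, rfl⟩ := exists_perm_pair hab hij
  exact Equiv.sum_comp (Equiv.mulRight τ)
    (fun π : Equiv.Perm (Fin n) => (g (π a) - g (π b)) ^ 2)

lemma sq_expand {n : ℕ} (c g : Fin n → ℝ) (hc : ∑ j, c j = 0) :
    (∑ j, c j * g j) ^ 2 = -(1 / 2) * ∑ i, ∑ j, c i * c j * (g i - g j) ^ 2 := by
  have h : ∀ i j, c i * c j * (g i - g j) ^ 2
      = (c i * g i ^ 2) * c j + c i * (c j * g j ^ 2) - 2 * ((c i * g i) * (c j * g j)) := by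
    intros; ring
  simp only [h, Finset.sum_add_distrib, Finset.sum_sub_distrib, ← Finset.mul_sum,
    ← Finset.sum_mul, hc]
  ring

lemma sum_sq {n : ℕ} (c g : Fin n → ℝ) (hc : ∑ j, c j = 0) {a b : Fin n} (hab : a ≠ b) :
    ∑ π : Equiv.Perm (Fin n), (∑ j, c j * g (π j)) ^ 2
      = (1 / 2) * (∑ π : Equiv.Perm (Fin n), (g (π a) - g (π b)) ^ 2) * ∑ j, c j ^ 2 := by
  set D := ∑ π : Equiv.Perm (Fin n), (g (π a) - g (π b)) ^ 2 with hD
  have h1 : ∀ π : Equiv.Perm (Fin n), (∑ j, c j * g (π j)) ^ 2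
      = -(1 / 2) * ∑ i, ∑ j, c i * c j * (g (π i) - g (π j)) ^ 2 :=
    fun π => sq_expand c (fun j => g (π j)) hc
  simp only [h1]
  rw [← Finset.mul_sum, Finset.sum_comm]
  have h2 : ∀ i, ∑ π : Equiv.Perm (Fin n), ∑ j, c i * c j * (g (π i) - g (π j)) ^ 2
      = - (D * c i ^ 2) := by
    intro i
    rw [Finset.sum_comm]
    have h3 : ∀ j, ∑ π : Equiv.Perm (Fin n), c i * c j * (g (π i) - g (π j)) ^ 2
        = D * c i * c j - if i = j then D * c i ^ 2 else 0 := by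
      intro j
      rw [← Finset.mul_sum]
      by_cases hij : i = j
      · subst hij; simp; ring
      · rw [Q_const g hab hij, if_neg hij]; ring
    simp only [h3, Finset.sum_sub_distrib, ← Finset.mul_sum, hc]
    simp
  simp only [h2, Finset.sum_neg_distrib, ← Finset.mul_sum]
  ring

lemma sum_loss {n : ℕ} (σ : ℝ) (g : Fin n → ℝ) {a b : Fin n} (hab : a ≠ b) (w : Fin n → Bool)
    (h : 0 < (treatedSet n w).card ∧ (treatedSet n w).card < n) :
    ∑ π : Equiv.Perm (Fin n), dmLoss n σ w (g ∘ π)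
      = ((1 / 2) * (∑ π : Equiv.Perm (Fin n), (g (π a) - g (π b)) ^ 2)
          + (Fintype.card (Equiv.Perm (Fin n)) : ℝ) * σ ^ 2) *
        (1 / ((treatedSet n w).card : ℝ) + 1 / ((n : ℝ) - (treatedSet n w).card)) := by
  simp only [dmLoss_eq, Finset.sum_add_distrib, Function.comp]
  rw [sum_sq (cw n w) g (cw_zero n w h) hab, cw_sq, Finset.sum_const, Finset.card_univ,
    nsmul_eq_mul, Finset.card_compl, Fintype.card_fin, Nat.cast_sub h.2.le]
  ring

lemma sum_risk {n : ℕ} (σ : ℝ) (η : (Fin n → Bool) → ℝ) (g : Fin n → ℝ) {a b : Fin n}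
    (hab : a ≠ b) :
    ∑ π : Equiv.Perm (Fin n), dmRisk n σ η (g ∘ π)
      = ∑ w ∈ Finset.univ.filter
      (fun w : Fin n → Bool => 0 < (treatedSet n w).card ∧ (treatedSet n w).card < n),
        η w * (((1 / 2) * (∑ π : Equiv.Perm (Fin n), (g (π a) - g (π b)) ^ 2)
          + (Fintype.card (Equiv.Perm (Fin n)) : ℝ) * σ ^ 2) *
        (1 / ((treatedSet n w).card : ℝ) + 1 / ((n : ℝ) - (treatedSet n w).card))) := by
  unfold dmRisk
  rw [Finset.sum_comm]
  refine Finset.sum_congr rfl fun w hw => ?_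
  rw [← Finset.mul_sum, sum_loss σ g hab w (by simpa using hw)]

lemma card_w (n k : ℕ) :
    (Finset.univ.filter (fun w : Fin n → Bool => (treatedSet n w).card = k)).card
      = n.choose k := by
  rw [← Fintype.card_fin n, ← Finset.card_univ, ← Finset.card_powersetCard, Finset.card_univ,
    Fintype.card_fin]
  refine Finset.card_nbij' (fun w => treatedSet n w) (fun s j => decide (j ∈ s)) ?_ ?_ ?_ ?_
  · intro w hw; simpa [Finset.mem_powersetCard] using hw
  · intro s hs
    have h1 : s.card = k := by simpa [Finset.mem_powersetCard] using hs
    have h2 : treatedSet n (fun j => decide (j ∈ s)) = s := by ext j; simp [treatedSet]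
    refine Finset.mem_coe.2 (Finset.mem_filter.2 ⟨Finset.mem_univ _, ?_⟩)
    rw [h2, h1]
  · intro w _; ext j; simp [treatedSet]
  · intro s _; ext j; simp [treatedSet]

lemma crd_sum (n : ℕ) (hn : 2 ≤ n) : ∑ w ∈ Finset.univ.filter
        (fun w : Fin n → Bool => 0 < (treatedSet n w).card ∧ (treatedSet n w).card < n),
      balancedCRD n w = 1 := by
  unfold balancedCRD
  rw [← Finset.sum_filter, Finset.filter_filter]
  have : Finset.univ.filter (fun w : Fin n → Bool =>
      (0 < (treatedSet n w).card ∧ (treatedSet n w).card < n) ∧ (treatedSet n w).card = n / 2)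
      = Finset.univ.filter (fun w : Fin n → Bool => (treatedSet n w).card = n / 2) := by
    ext w
    simp only [Finset.mem_filter, Finset.mem_univ, true_and]
    omega
  rw [this, Finset.sum_const, card_w, nsmul_eq_mul]
  have : (n.choose (n / 2) : ℝ) ≠ 0 := by
    exact_mod_cast (Nat.choose_pos (Nat.div_le_self n 2)).ne'
  field_simp

/-- The balanced completely randomized design is minimax optimal over a nonempty
permutation-invariant parameter set. -/
theorem balancedCRD_minimax
    (n : ℕ) (hn : 2 ≤ n) (hne : Even n) (σ : ℝ) (hσ : 0 ≤ σ)
    (G : Set (Fin n → ℝ)) (hGne : G.Nonempty)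
    (hGinv : ∀ g ∈ G, ∀ π : Equiv.Perm (Fin n), (fun j => g (π.symm j)) ∈ G)
    (η : (Fin n → Bool) → ℝ)
    (hη0 : ∀ w, 0 ≤ η w)
    (hηsupp : ∀ w : Fin n → Bool,
      ¬(0 < (treatedSet n w).card ∧ (treatedSet n w).card < n) → η w = 0)
    (hηsum : ∑ w ∈ Finset.univ.filter
        (fun w : Fin n → Bool => 0 < (treatedSet n w).card ∧ (treatedSet n w).card < n),
      η w = 1)
    (hbdd : BddAbove ((fun g => dmRisk n σ η g) '' G)) :
    (∀ g ∈ G, dmRisk n σ (balancedCRD n) g ≤ sSup ((fun g => dmRisk n σ η g) '' G)) ∧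
      sSup ((fun g => dmRisk n σ (balancedCRD n) g) '' G)
        ≤ sSup ((fun g => dmRisk n σ η g) '' G) := by
  have key : ∀ g ∈ G, dmRisk n σ (balancedCRD n) g ≤ sSup ((fun g => dmRisk n σ η g) '' G) := by
    intro g hg
    have hab : (⟨0, by omega⟩ : Fin n) ≠ ⟨1, by omega⟩ := by simp
    set S := sSup ((fun g => dmRisk n σ η g) '' G) with hS
    have e1 := sum_risk σ η g hab
    have e2 := sum_risk σ (balancedCRD n) g hab
    set K := ((1 / 2) * (∑ π : Equiv.Perm (Fin n),
        (g (π ⟨0, by omega⟩) - g (π ⟨1, by omega⟩)) ^ 2)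
          + (Fintype.card (Equiv.Perm (Fin n)) : ℝ) * σ ^ 2) with hK
    have hK0 : 0 ≤ K := by positivity
    have hn0 : (0 : ℝ) < n := by exact_mod_cast (by omega : 0 < n)
    have u1 : ∑ π : Equiv.Perm (Fin n), dmRisk n σ η (g ∘ π)
        ≤ (Fintype.card (Equiv.Perm (Fin n)) : ℝ) * S := by
      rw [← nsmul_eq_mul, ← Finset.card_univ]
      refine Finset.sum_le_card_nsmul _ _ _ fun π _ => ?_
      exact le_csSup hbdd ⟨g ∘ π, hGinv g hg π.symm, rfl⟩
    have l1 : K * (4 / n) ≤ ∑ π : Equiv.Perm (Fin n), dmRisk n σ η (g ∘ π) := by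
      rw [e1]
      calc K * (4 / n) = ∑ w ∈ Finset.univ.filter
            (fun w : Fin n → Bool => 0 < (treatedSet n w).card ∧ (treatedSet n w).card < n),
            η w * (K * (4 / n)) := by rw [← Finset.sum_mul, hηsum, one_mul]
        _ ≤ _ := by
          refine Finset.sum_le_sum fun w hw => ?_
          refine mul_le_mul_of_nonneg_left (mul_le_mul_of_nonneg_left ?_ hK0) (hη0 w)
          have hw' : 0 < (treatedSet n w).card ∧ (treatedSet n w).card < n := by simpa using hw
          have h1 : (0 : ℝ) < (treatedSet n w).card := by exact_mod_cast hw'.1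
          have h2 : (0 : ℝ) < n - (treatedSet n w).card := by
            rw [sub_pos]; exact_mod_cast hw'.2
          rw [div_add_div _ _ h1.ne' h2.ne', div_le_div_iff₀ hn0 (by positivity)]
          nlinarith [sq_nonneg ((n : ℝ) - 2 * (treatedSet n w).card)]
    have l2 : ∑ π : Equiv.Perm (Fin n), dmRisk n σ (balancedCRD n) (g ∘ π) = K * (4 / n) := by
      rw [e2]
      calc _ = ∑ w ∈ Finset.univ.filter
            (fun w : Fin n → Bool => 0 < (treatedSet n w).card ∧ (treatedSet n w).card < n),
            balancedCRD n w * (K * (4 / n)) := by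
            refine Finset.sum_congr rfl fun w _ => ?_
            by_cases hc : (treatedSet n w).card = n / 2
            · have : ((treatedSet n w).card : ℝ) = n / 2 := by
                rw [hc, Nat.cast_div hne.two_dvd (by norm_num)]; norm_num
              rw [this]
              congr 2
              field_simp
              norm_num
            · simp [balancedCRD, hc]
        _ = _ := by rw [← Finset.sum_mul, crd_sum n hn, one_mul]
    simp only [risk_inv, Finset.sum_const, Finset.card_univ, nsmul_eq_mul] at l2
    have hP : (0 : ℝ) < (Fintype.card (Equiv.Perm (Fin n)) : ℝ) := by
      exact_mod_cast Fintype.card_pos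
    refine le_of_mul_le_mul_left ?_ hP
    linarith
  refine ⟨key, csSup_le (hGne.image _) ?_⟩
  rintro _ ⟨g, hg, rfl⟩
  exact key g hg
end

section
/- Let n ≥ 2, let m be an integer with 1 ≤ m ≤ n−1, and let g ∈ ℝⁿ. Then (1 / C(n, m)) ∑_{S ⊆ {1,…,n}, |S| = m} ( (1/m) ∑_{j ∈ S} g_j − (1/(n−m)) ∑_{j ∉ S} g_j )² = ( 1/m + 1/(n−m) ) · ( (1/n) ∑_{j=1}^n g_j² − (1/(n(n−1))) ∑_{i ≠ j} g_i g_j ), where the last sum is over ordered pairs (i, j) with i ≠ j. In particular, the risk of the completely randomized design with m treated units factorizes into a size factor 1/m + 1/(n−m) and a factor depending only on g. -/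
open Finset

lemma crd_card (n m : ℕ) (s : Finset (Fin n)) (h : s.card ≤ m) :
    ((powersetCard m (univ : Finset (Fin n))).filter (s ⊆ ·)).card
      = (n - s.card).choose (m - s.card) := by
  rw [card_filter_powersetCard_subset _ _ _ (subset_univ s) h, card_univ, Fintype.card_fin]

lemma crd_c1 (n m : ℕ) (hn : 2 ≤ n) (hm1 : 1 ≤ m) (i : Fin n) :
    ((((powersetCard m (univ : Finset (Fin n))).filter (fun S => i ∈ S)).card : ℕ) : ℝ)
      = m * n.choose m / n := by
  have h := crd_card n m {i} (by simpa using hm1)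
  simp only [singleton_subset_iff, card_singleton] at h
  rw [h]
  obtain ⟨n, rfl⟩ := Nat.exists_eq_add_of_le' (show 1 ≤ n by omega)
  obtain ⟨m, rfl⟩ := Nat.exists_eq_add_of_le' hm1
  have := Nat.add_one_mul_choose_eq n m
  have h2 : ((n:ℝ) + 1) * n.choose m = (n+1).choose (m+1) * (m+1) := by exact_mod_cast this
  have : (n:ℝ)+1 ≠ 0 := by positivity
  simp only [Nat.add_sub_cancel]
  push_cast
  field_simp
  linarith

lemma crd_c2 (n m : ℕ) (hn : 2 ≤ n) (hm1 : 1 ≤ m) (i j : Fin n) (hij : i ≠ j) :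
    ((((powersetCard m (univ : Finset (Fin n))).filter (fun S => i ∈ S ∧ j ∈ S)).card : ℕ) : ℝ)
      = m * (m - 1) * n.choose m / (n * (n - 1)) := by
  by_cases hm : m = 1
  · subst hm
    simp only [Nat.cast_one, sub_self, mul_zero, zero_mul, zero_div, Nat.cast_eq_zero, card_eq_zero]
    refine filter_eq_empty_iff.2 ?_
    intro S hS h
    have := (mem_powersetCard.1 hS).2
    exact hij (card_le_one.1 this.le _ h.1 _ h.2)
  have h := crd_card n m {i, j} (by rw [card_pair hij]; omega)
  simp only [insert_subset_iff, singleton_subset_iff, card_pair hij] at h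
  rw [h]
  obtain ⟨n, rfl⟩ := Nat.exists_eq_add_of_le' hn
  obtain ⟨m, rfl⟩ := Nat.exists_eq_add_of_le' (show 2 ≤ m by omega)
  have h1 := Nat.add_one_mul_choose_eq n m
  have h2 := Nat.add_one_mul_choose_eq (n+1) (m+1)
  have h3 : ((n:ℝ) + 1) * n.choose m = (n+1).choose (m+1) * (m+1) := by exact_mod_cast h1
  have h4 : ((n:ℝ) + 1 + 1) * (n+1).choose (m+1) = (n+2).choose (m+2) * (m+1+1) := by
    exact_mod_cast h2
  simp only [Nat.add_sub_cancel]
  push_cast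
  rw [eq_div_iff]
  · linear_combination (n + 2 : ℝ) * h3 + (m + 1 : ℝ) * h4
  · have : (n:ℝ) + 2 - 1 = n + 1 := by ring
    rw [this]; positivity

lemma crd_sum1 (n m : ℕ) (hn : 2 ≤ n) (hm1 : 1 ≤ m) (g : Fin n → ℝ) :
    ∑ S ∈ powersetCard m (univ : Finset (Fin n)), ∑ j ∈ S, g j
      = (m * n.choose m / n) * ∑ j, g j := by
  have : ∀ S : Finset (Fin n), ∑ j ∈ S, g j = ∑ j, if j ∈ S then g j else 0 := by
    intro S; simp
  simp_rw [this]
  rw [sum_comm, mul_sum]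
  refine sum_congr rfl fun j _ => ?_
  rw [← sum_filter, sum_const, nsmul_eq_mul, crd_c1 n m hn hm1]
  simp

lemma crd_split (n : ℕ) (f : Fin n → Fin n → ℝ) :
    ∑ i, ∑ j, f i j = ∑ j, f j j
      + ∑ p ∈ (univ : Finset (Fin n × Fin n)).filter (fun p => p.1 ≠ p.2), f p.1 p.2 := by
  rw [← Fintype.sum_prod_type', ← sum_filter_add_sum_filter_not univ (fun p : Fin n × Fin n => p.1 = p.2)]
  congr 1
  rw [sum_filter, Fintype.sum_prod_type]
  simp

lemma crd_sum2 (n m : ℕ) (hn : 2 ≤ n) (hm1 : 1 ≤ m) (g : Fin n → ℝ) :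
    ∑ S ∈ powersetCard m (univ : Finset (Fin n)), (∑ j ∈ S, g j) ^ 2
      = (m * n.choose m / n) * ∑ j, g j ^ 2
        + (m * (m - 1) * n.choose m / (n * (n - 1))) *
          ∑ p ∈ (univ : Finset (Fin n × Fin n)).filter (fun p => p.1 ≠ p.2), g p.1 * g p.2 := by
  have : ∀ S : Finset (Fin n), (∑ j ∈ S, g j) ^ 2
      = ∑ i, ∑ j, if i ∈ S ∧ j ∈ S then g i * g j else 0 := by
    intro S
    have : ∑ j ∈ S, g j = ∑ j, if j ∈ S then g j else 0 := by simp
    rw [this, sq, sum_mul_sum]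
    refine sum_congr rfl fun i _ => sum_congr rfl fun j _ => ?_
    by_cases h1 : i ∈ S <;> by_cases h2 : j ∈ S <;> simp [h1, h2]
  simp_rw [this, crd_split]
  rw [sum_add_distrib, sum_comm, mul_sum]
  congr 1
  · refine sum_congr rfl fun j _ => ?_
    simp only [and_self]
    rw [← sum_filter, sum_const, nsmul_eq_mul, crd_c1 n m hn hm1, sq]
  · rw [sum_comm, mul_sum]
    refine sum_congr rfl fun p hp => ?_
    rw [← sum_filter, sum_const, nsmul_eq_mul, crd_c2 n m hn hm1 _ _ (mem_filter.1 hp).2]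

/-- The risk of the completely randomized design with `m` treated units factorizes into a
size factor `1/m + 1/(n−m)` and a factor depending only on `g`. -/
theorem crd_risk_factorization
    (n m : ℕ) (hn : 2 ≤ n) (hm1 : 1 ≤ m) (hm2 : m ≤ n - 1) (g : Fin n → ℝ) :
    (1 / (n.choose m : ℝ)) *
      ∑ S ∈ Finset.powersetCard m (univ : Finset (Fin n)),
        ((1 / (m : ℝ)) * ∑ j ∈ S, g j - (1 / ((n - m : ℕ) : ℝ)) * ∑ j ∈ Sᶜ, g j) ^ 2
    = (1 / (m : ℝ) + 1 / ((n - m : ℕ) : ℝ)) *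
        ((1 / (n : ℝ)) * ∑ j, g j ^ 2
          - (1 / ((n : ℝ) * ((n : ℝ) - 1))) *
            ∑ p ∈ (univ : Finset (Fin n × Fin n)).filter (fun p => p.1 ≠ p.2),
              g p.1 * g p.2) := by
  have e : ∀ (a b : ℝ) (S : Finset (Fin n)), (a * ∑ j ∈ S, g j - b * ∑ j ∈ Sᶜ, g j) ^ 2
      = (a + b) ^ 2 * (∑ j ∈ S, g j) ^ 2 - (2 * (a + b) * b * ∑ j, g j) * (∑ j ∈ S, g j)
        + b ^ 2 * (∑ j, g j) ^ 2 := by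
    intro a b S
    rw [← sum_add_sum_compl S g]
    ring
  simp_rw [e]
  rw [sum_add_distrib, sum_sub_distrib, ← mul_sum, ← mul_sum, crd_sum1 n m hn hm1,
    crd_sum2 n m hn hm1, sum_const, card_powersetCard, card_univ, Fintype.card_fin, nsmul_eq_mul]
  have hT : (∑ j, g j) ^ 2 = ∑ j, g j ^ 2
      + ∑ p ∈ (univ : Finset (Fin n × Fin n)).filter (fun p => p.1 ≠ p.2), g p.1 * g p.2 := by
    rw [sq, sum_mul_sum, crd_split]
    simp [sq]
  generalize (∑ p ∈ (univ : Finset (Fin n × Fin n)).filter (fun p => p.1 ≠ p.2),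
    g p.1 * g p.2) = R at *
  generalize (∑ j, g j ^ 2) = Q at *
  generalize (∑ j, g j) = T at *
  obtain rfl : R = T ^ 2 - Q := by linarith
  have hN : (n.choose m : ℝ) ≠ 0 := by
    exact_mod_cast (Nat.choose_pos (show m ≤ n by omega)).ne'
  generalize (n.choose m : ℝ) = N at *
  have hk : 0 < n - m := by omega
  obtain ⟨k, hk'⟩ : ∃ k, n - m = k := ⟨_, rfl⟩
  rw [hk'] at hk ⊢
  have hnk : (n : ℝ) = m + k := by
    have : n = m + k := by omega
    exact_mod_cast this
  have hm0 : (1 : ℝ) ≤ m := by exact_mod_cast hm1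
  have hk0 : (1 : ℝ) ≤ k := by exact_mod_cast hk
  rw [hnk]
  generalize (m : ℝ) = m at *
  generalize (k : ℝ) = k at *
  have h1 : m ≠ 0 := by linarith
  have h2 : k ≠ 0 := by linarith
  have h3 : m + k ≠ 0 := by linarith
  have h4 : m + k - 1 ≠ 0 := by linarith
  field_simp
  ring
end

section
/- Let n ≥ 1, b > 0, and p ∈ (0,1)ⁿ with 0 < p_j < 1 for each j. For y(1), y(0) ∈ ℝⁿ let R(p, y) = ∑_{w ∈ {0,1}ⁿ} ( ∏_{j=1}^n p_j^{w_j}(1−p_j)^{1−w_j} ) · ( τ̂(w) − τ̄ )², where τ̂(w) = (1/n) ∑_j ( y_j(1)·1{w_j=1}/p_j − y_j(0)·1{w_j=0}/(1−p_j) ) and τ̄ = (1/n) ∑_j (y_j(1) − y_j(0)). Then (i) for all y(1), y(0) with every entry in [−b, b], R(p, y) ≤ (b²/n²) ∑_{j=1}^n 1/(p_j(1−p_j)); and (ii) equality holds when y_j(1) = y_j(0) = b for every j. In particular the worst-case potential outcomes over the uniform uncertainty set [−b, b]^{2n} satisfy y_j(1) = y_j(0) = ±b. -/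
open Finset

/-- The mean squared error of the IPW estimator under the Bernoulli design with
unit-specific treatment probabilities `p` and potential outcomes `y1`, `y0`. -/
noncomputable def ipwMSE (n : ℕ) (p y1 y0 : Fin n → ℝ) : ℝ :=
  ∑ w : Fin n → Bool,
    (∏ j, if w j then p j else 1 - p j) *
      ((1 / (n : ℝ)) * ∑ j,
        (y1 j * (if w j = true then (1 : ℝ) else 0) / p j
          - y0 j * (if w j = false then (1 : ℝ) else 0) / (1 - p j))
        - (1 / (n : ℝ)) * ∑ j, (y1 j - y0 j)) ^ 2

lemma sum_cons_bool (n : ℕ) (F : (Fin (n+1) → Bool) → ℝ) :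
    ∑ w, F w = ∑ w : Fin n → Bool, (F (Fin.cons true w) + F (Fin.cons false w)) := by
  rw [← Equiv.sum_comp (Fin.consEquiv (fun _ : Fin (n+1) => Bool)) F, Fintype.sum_prod_type,
    Fintype.sum_bool, ← Finset.sum_add_distrib]
  rfl

lemma bern_moments (n : ℕ) (q x : Fin n → Bool → ℝ)
    (hq : ∀ j, q j true + q j false = 1)
    (hx : ∀ j, q j true * x j true + q j false * x j false = 0) :
    (∑ w : Fin n → Bool, ∏ j, q j (w j)) = 1 ∧
    (∑ w : Fin n → Bool, (∏ j, q j (w j)) * ∑ j, x j (w j)) = 0 ∧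
    (∑ w : Fin n → Bool, (∏ j, q j (w j)) * (∑ j, x j (w j)) ^ 2)
      = ∑ j, (q j true * x j true ^ 2 + q j false * x j false ^ 2) := by
  induction n with
  | zero => simp
  | succ n ih =>
    obtain ⟨h1, h2, h3⟩ := ih (fun j => q j.succ) (fun j => x j.succ)
      (fun j => hq _) (fun j => hx _)
    have a := hq 0
    have c := hx 0
    refine ⟨?_, ?_, ?_⟩
    · rw [sum_cons_bool, ← h1]
      refine Finset.sum_congr rfl fun w _ => ?_
      simp only [Fin.prod_univ_succ, Fin.cons_zero, Fin.cons_succ]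
      rw [← add_mul, a, one_mul]
    · rw [sum_cons_bool, ← h2]
      refine Finset.sum_congr rfl fun w _ => ?_
      simp only [Fin.prod_univ_succ, Fin.sum_univ_succ, Fin.cons_zero, Fin.cons_succ]
      generalize ∏ j : Fin n, q j.succ (w j) = P
      generalize ∑ j : Fin n, x j.succ (w j) = S
      linear_combination P * S * a + P * c
    · rw [sum_cons_bool, Fin.sum_univ_succ, ← h3,
        ← mul_one (q 0 true * x 0 true ^ 2 + q 0 false * x 0 false ^ 2), ← h1,
        Finset.mul_sum, ← Finset.sum_add_distrib]
      refine Finset.sum_congr rfl fun w _ => ?_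
      simp only [Fin.prod_univ_succ, Fin.sum_univ_succ, Fin.cons_zero, Fin.cons_succ]
      generalize ∏ j : Fin n, q j.succ (w j) = P
      generalize ∑ j : Fin n, x j.succ (w j) = S
      linear_combination P * S ^ 2 * a + 2 * P * S * c

lemma ipwMSE_eq (n : ℕ) (p y1 y0 : Fin n → ℝ) (hp : ∀ j, 0 < p j ∧ p j < 1) :
    ipwMSE n p y1 y0 =
      (1 / (n : ℝ) ^ 2) * ∑ j, (y1 j * (1 - p j) + y0 j * p j) ^ 2 / (p j * (1 - p j)) := by
  have key := (bern_moments n (fun j c => if c then p j else 1 - p j)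
    (fun j c => (y1 j * (if c = true then (1 : ℝ) else 0) / p j
          - y0 j * (if c = false then (1 : ℝ) else 0) / (1 - p j)) - (y1 j - y0 j))
    (fun j => by simp) (fun j => by
      have h1 := (hp j).1.ne'
      have h2 : 1 - p j ≠ 0 := by linarith [(hp j).2]
      simp
      field_simp
      ring)).2.2
  have e := key.trans (show _ = ∑ j, (y1 j * (1 - p j) + y0 j * p j) ^ 2 / (p j * (1 - p j)) by
    refine Finset.sum_congr rfl fun j _ => ?_
    have h1 := (hp j).1.ne'
    have h2 : 1 - p j ≠ 0 := by linarith [(hp j).2]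
    simp
    field_simp
    ring)
  rw [← e, ipwMSE, Finset.mul_sum (a := 1 / (n : ℝ) ^ 2)]
  refine Finset.sum_congr rfl fun w _ => ?_
  rw [← mul_sub, ← Finset.sum_sub_distrib]
  ring

/-- Over the uniform uncertainty set `[−b, b]^{2n}`, the worst-case MSE of the IPW
estimator under the Bernoulli design equals `(b²/n²) ∑_j 1/(p_j(1−p_j))`, attained at
`y_j(1) = y_j(0) = b`. -/
theorem ipw_worst_case_uniform_uncertainty
    (n : ℕ) (hn : 1 ≤ n) (b : ℝ) (hb : 0 < b)
    (p : Fin n → ℝ) (hp : ∀ j, 0 < p j ∧ p j < 1) :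
    (∀ y1 y0 : Fin n → ℝ, (∀ j, |y1 j| ≤ b) → (∀ j, |y0 j| ≤ b) →
      ipwMSE n p y1 y0 ≤ (b ^ 2 / (n : ℝ) ^ 2) * ∑ j, 1 / (p j * (1 - p j))) ∧
    ipwMSE n p (fun _ => b) (fun _ => b)
      = (b ^ 2 / (n : ℝ) ^ 2) * ∑ j, 1 / (p j * (1 - p j)) := by
  constructor
  · intro y1 y0 h1 h0
    rw [ipwMSE_eq n p y1 y0 hp, div_eq_mul_one_div (b ^ 2), mul_comm (b ^ 2), mul_assoc,
      Finset.mul_sum (a := b ^ 2)]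
    refine mul_le_mul_of_nonneg_left (Finset.sum_le_sum fun j _ => ?_) (by positivity)
    have hp1 := (hp j).1
    have hp2 : 0 < 1 - p j := by linarith [(hp j).2]
    rw [mul_one_div]
    refine div_le_div_of_nonneg_right ?_ (by positivity)
    have u := abs_le.1 (h1 j)
    have v := abs_le.1 (h0 j)
    apply sq_le_sq'
    · nlinarith [mul_le_mul_of_nonneg_right u.1 hp2.le, mul_le_mul_of_nonneg_right v.1 hp1.le]
    · nlinarith [mul_le_mul_of_nonneg_right u.2 hp2.le, mul_le_mul_of_nonneg_right v.2 hp1.le]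
  · rw [ipwMSE_eq n p _ _ hp, div_eq_mul_one_div (b ^ 2), mul_comm (b ^ 2), mul_assoc,
      Finset.mul_sum (a := b ^ 2)]
    congr 1
    refine Finset.sum_congr rfl fun j _ => ?_
    rw [mul_one_div]
    congr 1
    ring
end

section
/- Let n ≥ 2 be an even integer and let g ∈ ℝⁿ satisfy g₁ ≥ g₂ ≥ ⋯ ≥ g_n. Let {S₁,…,S_k} be any partition of {1,…,n} in which every block S_l has even cardinality s_l ≥ 2. Then ∑_{l=1}^k ( 1/(s_l − 1) ) ∑_{i < j, i,j ∈ S_l} (g_i − g_j)² ≥ ∑_{m=1}^{n/2} (g_{2m−1} − g_{2m})², and the matched-pair partition { {1,2}, {3,4}, …, {n−1,n} } attains the right-hand side. Consequently, among all stratified completely randomized designs with even strata sizes and treatment probability 1/2, the matched-pair design pairing consecutive sorted baselines minimizes the variance criterion ∑_l (1/(4(s_l−1))) ∑_{i<j ∈ S_l} (g_i − g_j)². -/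
open Finset

lemma mp_aux_lin (G : ℕ → ℝ) (hG : Antitone G) (i j : ℕ) (M : ℕ) :
    ∑ m ∈ Finset.range M, (if i ≤ 2 * m ∧ 2 * m < j then G (2 * m) - G (2 * m + 1) else 0)
      ≤ G i - G (max i (min j (2 * M))) := by
  induction M with
  | zero => simp
  | succ M ih =>
    rw [Finset.sum_range_succ]
    split_ifs with h
    · have e1 : max i (min j (2 * M)) = 2 * M := by omega
      have h2 : G (max i (min j (2 * (M + 1)))) ≤ G (2 * M + 1) := hG (by omega)
      rw [e1] at ih
      linarith
    · have h2 : G (max i (min j (2 * (M + 1)))) ≤ G (max i (min j (2 * M))) := hG (by omega)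
      linarith

lemma mp_aux_sq (G : ℕ → ℝ) (hG : Antitone G) (i j : ℕ) (hij : i ≤ j) (M : ℕ) :
    ∑ m ∈ Finset.range M, (if i ≤ 2 * m ∧ 2 * m < j then (G (2 * m) - G (2 * m + 1)) ^ 2 else 0)
      ≤ (G i - G j) ^ 2 := by
  have h0 : ∀ m ∈ Finset.range M,
      0 ≤ (if i ≤ 2 * m ∧ 2 * m < j then G (2 * m) - G (2 * m + 1) else 0) := by
    intro m _
    split_ifs
    · exact sub_nonneg.2 (hG (by omega))
    · exact le_rfl
  have h1 := Finset.sum_sq_le_sq_sum_of_nonneg h0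
  have h2 := mp_aux_lin G hG i j M
  have h3 : G j ≤ G (max i (min j (2 * M))) := hG (by omega)
  have h4 := pow_le_pow_left₀ (Finset.sum_nonneg h0) (h2.trans (sub_le_sub_left h3 _)) 2
  refine le_trans (le_of_eq ?_) (h1.trans h4)
  refine Finset.sum_congr rfl fun m _ => ?_
  split_ifs <;> simp

lemma mp_block (n : ℕ) (T : Finset (Fin n)) (t : ℕ) :
    ((T ×ˢ T).filter (fun p => p.1 < p.2)).filter (fun p => p.1.1 ≤ t ∧ t < p.2.1)
      = (T.filter (fun x => x.1 ≤ t)) ×ˢ (T.filter (fun x => ¬ x.1 ≤ t)) := by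
  ext ⟨x, y⟩
  simp only [Finset.mem_filter, Finset.mem_product, Fin.lt_def]
  constructor
  · rintro ⟨⟨⟨a, b⟩, c⟩, d, e⟩
    exact ⟨⟨a, d⟩, b, by omega⟩
  · rintro ⟨⟨a, d⟩, b, e⟩
    exact ⟨⟨⟨a, b⟩, by omega⟩, d, by omega⟩

lemma mp_exists_odd (n k : ℕ) (S : Fin k → Finset (Fin n))
    (hdisj : ∀ l l' : Fin k, l ≠ l' → Disjoint (S l) (S l'))
    (hcover : ∀ j : Fin n, ∃ l : Fin k, j ∈ S l) (t : ℕ) (ht : t < n) (hte : Even t) :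
    ∃ l, Odd ((S l).filter (fun x => x.1 ≤ t)).card := by
  by_contra! hcon
  have h1 : (Finset.univ.biUnion fun l => (S l).filter (fun x => x.1 ≤ t)) = Finset.Iic ⟨t, ht⟩ := by
    ext x
    simp only [Finset.mem_biUnion, Finset.mem_univ, true_and, Finset.mem_filter, Finset.mem_Iic,
      Fin.le_def]
    constructor
    · rintro ⟨l, _, h⟩; exact h
    · intro h
      obtain ⟨l, hl⟩ := hcover x
      exact ⟨l, hl, h⟩
  have h2 := congrArg Finset.card h1
  rw [Finset.card_biUnion, Fin.card_Iic] at h2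
  · have h3 : 2 ∣ ∑ l, ((S l).filter (fun x => x.1 ≤ t)).card :=
      Finset.dvd_sum fun l _ => (Nat.not_odd_iff_even.1 (hcon l)).two_dvd
    rw [h2] at h3
    have := hte.two_dvd
    simp at h3
    omega
  · intro l _ l' _ hl
    exact Finset.disjoint_filter_filter (hdisj l l' hl)

lemma mp_main (n : ℕ) (G : ℕ → ℝ) (hG : Antitone G)
    (k : ℕ) (S : Fin k → Finset (Fin n))
    (hdisj : ∀ l l' : Fin k, l ≠ l' → Disjoint (S l) (S l'))
    (hcover : ∀ j : Fin n, ∃ l : Fin k, j ∈ S l)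
    (heven : ∀ l : Fin k, Even (S l).card)
    (hsize : ∀ l : Fin k, 2 ≤ (S l).card) :
    ∑ m ∈ Finset.range (n / 2), (G (2 * m) - G (2 * m + 1)) ^ 2
      ≤ ∑ l : Fin k,
          (1 / (((S l).card : ℝ) - 1)) *
            ∑ p ∈ (S l ×ˢ S l).filter (fun p => p.1 < p.2), (G p.1.1 - G p.2.1) ^ 2 := by
  have hs : ∀ l, (0 : ℝ) < ((S l).card : ℝ) - 1 := by
    intro l
    have : (2 : ℝ) ≤ (S l).card := by exact_mod_cast hsize l
    linarith
  have hblock : ∀ l, (1 / (((S l).card : ℝ) - 1)) *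
      ∑ m ∈ Finset.range (n / 2),
        (((S l).filter (fun x => x.1 ≤ 2 * m)).card : ℝ) *
          ((S l).filter (fun x => ¬ x.1 ≤ 2 * m)).card * (G (2 * m) - G (2 * m + 1)) ^ 2
      ≤ (1 / (((S l).card : ℝ) - 1)) *
            ∑ p ∈ (S l ×ˢ S l).filter (fun p => p.1 < p.2), (G p.1.1 - G p.2.1) ^ 2 := by
    intro l
    refine mul_le_mul_of_nonneg_left ?_ (one_div_nonneg.2 (hs l).le)
    refine le_trans (le_of_eq ?_) (Finset.sum_le_sum fun p hp =>
      mp_aux_sq G hG p.1.1 p.2.1 (le_of_lt (Finset.mem_filter.1 hp).2) (n / 2))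
    rw [Finset.sum_comm]
    refine Finset.sum_congr rfl fun m _ => ?_
    rw [← Finset.sum_filter, mp_block, Finset.sum_const, Finset.card_product, nsmul_eq_mul]
    push_cast
    rfl
  refine le_trans ?_ (Finset.sum_le_sum fun l _ => hblock l)
  simp_rw [Finset.mul_sum]
  rw [Finset.sum_comm]
  refine Finset.sum_le_sum fun m hm => ?_
  have hm' := Finset.mem_range.1 hm
  obtain ⟨l, hl⟩ := mp_exists_odd n k S hdisj hcover (2 * m) (by omega) (even_two_mul m)
  refine le_trans ?_ (Finset.single_le_sum (f := fun l => (1 / (((S l).card : ℝ) - 1)) *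
        ((((S l).filter (fun x => x.1 ≤ 2 * m)).card : ℝ) *
          ((S l).filter (fun x => ¬ x.1 ≤ 2 * m)).card * (G (2 * m) - G (2 * m + 1)) ^ 2))
      (fun l _ => mul_nonneg (one_div_nonneg.2 (hs l).le) (by positivity)) (Finset.mem_univ l))
  have hc := Finset.card_filter_add_card_filter_not (s := S l) (fun x => x.1 ≤ 2 * m)
  have hsl := hs l
  have he := heven l
  show _ ≤ (1 / (((S l).card : ℝ) - 1)) *
        ((((S l).filter (fun x => x.1 ≤ 2 * m)).card : ℝ) *
          ((S l).filter (fun x => ¬ x.1 ≤ 2 * m)).card * (G (2 * m) - G (2 * m + 1)) ^ 2)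
  generalize ((S l).filter (fun x => x.1 ≤ 2 * m)).card = a at *
  generalize ((S l).filter (fun x => ¬ x.1 ≤ 2 * m)).card = b at *
  generalize (S l).card = s at *
  have ha1 : 1 ≤ a := hl.pos
  have hb1 : 1 ≤ b := by
    obtain ⟨x, hx⟩ := hl
    obtain ⟨y, hy⟩ := he
    omega
  have ha : (1 : ℝ) ≤ a := by exact_mod_cast ha1
  have hb : (1 : ℝ) ≤ b := by exact_mod_cast hb1
  have hcr : (a : ℝ) + b = s := by exact_mod_cast hc
  rw [one_div, ← div_eq_inv_mul, le_div_iff₀ hsl, mul_comm]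
  refine mul_le_mul_of_nonneg_right ?_ (sq_nonneg _)
  nlinarith [mul_nonneg (sub_nonneg.2 ha) (sub_nonneg.2 hb)]

/-- Among all stratified completely randomized designs with even strata sizes and
treatment probability 1/2, the matched-pair design pairing consecutive sorted baselines
minimizes the variance criterion, and the matched-pair partition attains the lower
bound `∑_m (g_{2m−1} − g_{2m})²`. -/
theorem matched_pair_optimal
    (n : ℕ) (hn : 2 ≤ n) (hne : n % 2 = 0)
    (g : Fin n → ℝ) (hsorted : ∀ i j : Fin n, i ≤ j → g j ≤ g i)
    (k : ℕ) (S : Fin k → Finset (Fin n))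
    (hdisj : ∀ l l' : Fin k, l ≠ l' → Disjoint (S l) (S l'))
    (hcover : ∀ j : Fin n, ∃ l : Fin k, j ∈ S l)
    (heven : ∀ l : Fin k, Even (S l).card)
    (hsize : ∀ l : Fin k, 2 ≤ (S l).card) :
    (∑ m : Fin (n / 2),
        (g ⟨2 * m.1, by have := m.2; omega⟩ - g ⟨2 * m.1 + 1, by have := m.2; omega⟩) ^ 2
      ≤ ∑ l : Fin k,
          (1 / (((S l).card : ℝ) - 1)) *
            ∑ p ∈ (S l ×ˢ S l).filter (fun p => p.1 < p.2), (g p.1 - g p.2) ^ 2) ∧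
    (∑ m : Fin (n / 2),
        (1 / (((({⟨2 * m.1, by have := m.2; omega⟩,
                    ⟨2 * m.1 + 1, by have := m.2; omega⟩} : Finset (Fin n))).card : ℝ) - 1)) *
          ∑ p ∈ (({⟨2 * m.1, by have := m.2; omega⟩,
                    ⟨2 * m.1 + 1, by have := m.2; omega⟩} : Finset (Fin n)) ×ˢ
                  ({⟨2 * m.1, by have := m.2; omega⟩,
                    ⟨2 * m.1 + 1, by have := m.2; omega⟩} : Finset (Fin n))).filter
                (fun p => p.1 < p.2),
            (g p.1 - g p.2) ^ 2
      = ∑ m : Fin (n / 2),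
          (g ⟨2 * m.1, by have := m.2; omega⟩
            - g ⟨2 * m.1 + 1, by have := m.2; omega⟩) ^ 2) := by
  constructor
  · let G : ℕ → ℝ := fun x => g ⟨min x (n - 1), by omega⟩
    have hG : Antitone G := by
      intro x y hxy
      apply hsorted
      simp only [Fin.le_def]
      omega
    have hGv : ∀ x (h : x < n), G x = g ⟨x, h⟩ := by
      intro x h
      simp only [G]
      congr 2
      omega
    have h := mp_main n G hG k S hdisj hcover heven hsize
    rw [← Fin.sum_univ_eq_sum_range (fun m => (G (2 * m) - G (2 * m + 1)) ^ 2)] at h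
    convert h using 2 with m _ l _
    · rw [hGv, hGv]
    · congr 1
      refine Finset.sum_congr rfl fun p _ => ?_
      rw [hGv _ p.1.2, hGv _ p.2.2]
  · refine Finset.sum_congr rfl fun m _ => ?_
    have hab : (⟨2 * m.1, by have := m.2; omega⟩ : Fin n)
        < ⟨2 * m.1 + 1, by have := m.2; omega⟩ := by
      simp [Fin.lt_def]
    generalize (⟨2 * m.1, by have := m.2; omega⟩ : Fin n) = a at *
    generalize (⟨2 * m.1 + 1, by have := m.2; omega⟩ : Fin n) = b at *
    have hf : (({a, b} : Finset (Fin n)) ×ˢ ({a, b} : Finset (Fin n))).filter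
        (fun p => p.1 < p.2) = {(a, b)} := by
      ext ⟨x, y⟩
      simp only [Finset.mem_filter, Finset.mem_product, Finset.mem_insert, Finset.mem_singleton,
        Prod.mk.injEq]
      constructor
      · rintro ⟨⟨rfl | rfl, rfl | rfl⟩, h⟩
        · exact absurd h (lt_irrefl _)
        · exact ⟨rfl, rfl⟩
        · exact absurd h (lt_asymm hab)
        · exact absurd h (lt_irrefl _)
      · rintro ⟨rfl, rfl⟩
        exact ⟨⟨Or.inl rfl, Or.inr rfl⟩, hab⟩
    rw [hf, Finset.sum_singleton, Finset.card_pair hab.ne]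
    norm_num
end

section
/- Let n ≥ 2 be an even integer and let g ∈ ℝⁿ satisfy g₁ ≥ g₂ ≥ ⋯ ≥ g_n. For any perfect matching of {1,…,n}, i.e., any partition of {1,…,n} into n/2 pairs {i_m, j_m} (m = 1,…,n/2), it holds that ∑_{m=1}^{n/2} (g_{i_m} − g_{j_m})² ≥ ∑_{m=1}^{n/2} (g_{2m−1} − g_{2m})²; that is, pairing consecutive elements in sorted order minimizes the sum of squared within-pair differences over all perfect matchings. -/
open Finset

lemma aux_sum_sq (G : ℕ → ℝ) (hG : Antitone G) (p q : ℕ) (h : p ≤ q) :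
    ∑ i ∈ Finset.Ico p q, (G i - G (i+1))^2 ≤ (G p - G q)^2 := by
  induction q, h using Nat.le_induction with
  | base => simp
  | succ q h ih =>
    rw [Finset.sum_Ico_succ_top h]
    have h1 := hG h
    have h2 := hG (Nat.le_succ q)
    simp only [Nat.succ_eq_add_one] at h2
    nlinarith [mul_nonneg (sub_nonneg.2 h1) (sub_nonneg.2 h2)]

lemma aux_cross (G : ℕ → ℝ) (hG : Antitone G) (N p q : ℕ) (h : p ≤ q) :
    ∑ k : Fin N, (if p ≤ 2 * k.1 ∧ 2 * k.1 < q then (G (2*k.1) - G (2*k.1+1))^2 else 0)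
      ≤ (G p - G q)^2 := by
  refine le_trans ?_ (aux_sum_sq G hG p q h)
  rw [← Finset.sum_filter]
  have inj : Set.InjOn (fun k : Fin N => 2 * k.1)
      (Finset.univ.filter (fun k : Fin N => p ≤ 2 * k.1 ∧ 2 * k.1 < q) : Finset (Fin N)) := by
    intro x _ y _ hxy
    simp only at hxy
    ext
    omega
  rw [← Finset.sum_image (f := fun i => (G i - G (i+1))^2) inj]
  refine Finset.sum_le_sum_of_subset_of_nonneg ?_ (fun _ _ _ => sq_nonneg _)
  intro i hi
  simp only [Finset.mem_image, Finset.mem_filter, Finset.mem_univ, true_and] at hi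
  obtain ⟨k, hk, rfl⟩ := hi
  simpa using hk

lemma aux_exists (n : ℕ) (a b : Fin (n / 2) → Fin n)
    (hmatch : Function.Bijective
      (fun x : Fin (n / 2) × Bool => if x.2 then a x.1 else b x.1)) (k : ℕ) (hk : 2 * k < n) :
    ∃ m, min (a m).1 (b m).1 ≤ 2 * k ∧ 2 * k < max (a m).1 (b m).1 := by
  by_contra! hcon
  have h1 : ∑ i : Fin n, (if i.1 ≤ 2 * k then 1 else 0) = 2 * k + 1 := by
    rw [Fin.sum_univ_eq_sum_range (fun i => if i ≤ 2 * k then 1 else 0) n, ← Finset.sum_filter]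
    have : (Finset.range n).filter (fun i => i ≤ 2 * k) = Finset.range (2 * k + 1) := by
      ext i
      simp only [Finset.mem_filter, Finset.mem_range]
      omega
    rw [this]
    simp
  rw [← hmatch.sum_comp (fun i : Fin n => if i.1 ≤ 2 * k then 1 else 0),
    Fintype.sum_prod_type] at h1
  have h2 : ∀ m : Fin (n/2), (∑ y : Bool,
      (if (if y then a m else b m).1 ≤ 2 * k then 1 else 0)) =
        2 * (if (a m).1 ≤ 2 * k then 1 else 0) := by
    intro m
    have := hcon m
    rw [Fintype.sum_bool]
    simp only [if_true, Bool.false_eq_true, if_false]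
    split_ifs <;> omega
  simp only [h2] at h1
  rw [← Finset.mul_sum] at h1
  omega

/-- Pairing consecutive elements in sorted order minimizes the sum of squared
within-pair differences over all perfect matchings of `{1,…,n}` (`n` even). -/
theorem sorted_pairing_minimizes
    (n : ℕ) (hn : 2 ≤ n) (hne : n % 2 = 0)
    (g : Fin n → ℝ) (hsorted : ∀ i j : Fin n, i ≤ j → g j ≤ g i)
    (a b : Fin (n / 2) → Fin n)
    (hmatch : Function.Bijective
      (fun x : Fin (n / 2) × Bool => if x.2 then a x.1 else b x.1)) :
    ∑ m : Fin (n / 2),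
        (g ⟨2 * m.1, by have := m.2; omega⟩ - g ⟨2 * m.1 + 1, by have := m.2; omega⟩) ^ 2
      ≤ ∑ m : Fin (n / 2), (g (a m) - g (b m)) ^ 2 := by
  obtain ⟨G, hGdef⟩ : ∃ G : ℕ → ℝ, G = fun i => g ⟨min i (n-1), by omega⟩ := ⟨_, rfl⟩
  have hG : Antitone G := by
    intro i j hij
    rw [hGdef]
    apply hsorted
    simp only [Fin.mk_le_mk]
    omega
  have hGg : ∀ i (hi : i < n), g ⟨i, hi⟩ = G i := by
    intro i hi
    rw [hGdef]
    simp only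
    congr 2
    omega
  have hR : ∀ m, (g (a m) - g (b m))^2
      = (G (min (a m).1 (b m).1) - G (max (a m).1 (b m).1))^2 := by
    intro m
    have e1 := hGg (a m).1 (a m).2
    have e2 := hGg (b m).1 (b m).2
    simp only [Fin.eta] at e1 e2
    rw [e1, e2]
    rcases le_total (a m).1 (b m).1 with h | h
    · rw [min_eq_left h, max_eq_right h]
    · rw [min_eq_right h, max_eq_left h]
      ring
  rw [Finset.sum_congr rfl fun m _ => hR m]
  simp only [hGg]
  refine le_trans ?_ (Finset.sum_le_sum fun m _ => aux_cross G hG (n/2) _ _ min_le_max)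
  rw [Finset.sum_comm]
  refine Finset.sum_le_sum fun k _ => ?_
  obtain ⟨m, hm⟩ := aux_exists n a b hmatch k.1 (by have := k.2; omega)
  refine le_trans ?_ (Finset.single_le_sum (fun i _ => ?_) (Finset.mem_univ m))
  · rw [if_pos hm]
  · split_ifs
    · exact sq_nonneg _
    · exact le_rfl
end
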